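/- Fix integers n, N ≥ 1, Schwartz functions λ' on ℝ and λ'' on ℝ³, and signs ε_{M,j} ∈ {−1, +1} for 1 ≤ M ≤ N, 1 ≤ j ≤ n. For a = (a₁,…,a_n) ∈ (ℝ⁴)^n set κ(a) = (1/n) Σ_{j=1}^n a_j = (κ(a)⁰, 𝛋(a)) and G(a) = λ'(κ(a)⁰) λ''(𝛋(a)) exp( −(1/2) Σ_{j=1}^n |a_j − κ(a)|_E² ), and define F : ((ℝ⁴)^n)^N → ℂ by F(k₁,…,k_N) = ∫_{((ℝ⁴)^n)^N} ( ∏_{M=1}^{N−1} 𝟙[ κ(a_M)⁰ ≤ κ(a_{M+1})⁰ ] ) ( ∏_{M=1}^N G(a_M) ) exp( i Σ_{M=1}^N Σ_{j=1}^n ε_{M,j} k_{M,j} · a_{M,j} ) da₁⋯da_N, where · is the Minkowski pairing. Then there exists a constant C > 0 such that for all k₁, …, k_N ∈ (ℝ⁴)^n, |F(k₁,…,k_N)| ≤ C ∏_{M=1}^N exp( −(1/2) Σ_{j=1}^n | ε_{M,j} k_{M,j} − κ_M |_E² ), where κ_M = (1/n) Σ_{j=1}^n ε_{M,j} k_{M,j}.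 -/

import Mathlib

open MeasureTheory
open scoped BigOperators

/-- The Minkowski pairing `k·a = k⁰a⁰ − 𝐤·𝐚` on ℝ⁴. -/
noncomputable def mink (k a : Fin 4 → ℝ) : ℝ :=
  k 0 * a 0 - (k 1 * a 1 + k 2 * a 2 + k 3 * a 3)

/-- The mean point `κ(a) = (1/n) Σ_j a_j` of `a ∈ (ℝ⁴)^n`. -/
noncomputable def meanPt {n : ℕ} (a : Fin n → Fin 4 → ℝ) : Fin 4 → ℝ :=
  (n : ℝ)⁻¹ • ∑ j, a j

/-- The Gaussian cutoff factor
`G(a) = λ'(κ(a)⁰) λ''(𝛋(a)) exp(−(1/2) Σ_j |a_j − κ(a)|_E²)`. -/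
noncomputable def gaussCutoff {n : ℕ} (lam' : SchwartzMap ℝ ℂ)
    (lam'' : SchwartzMap (Fin 3 → ℝ) ℂ) (a : Fin n → Fin 4 → ℝ) : ℂ :=
  lam' (meanPt a 0) * lam'' (fun i : Fin 3 => meanPt a i.succ) *
    (Real.exp (-(1/2) * ∑ j, ∑ μ : Fin 4, (a j μ - meanPt a μ) ^ 2) : ℂ)

/-- The kernel `F(k₁,…,k_N)`, an integral over `((ℝ⁴)^n)^N` with average-time
ordering, Gaussian cutoffs, and oscillating Minkowski phases with signs `ε`. -/
noncomputable def kernelF (n N : ℕ) (lam' : SchwartzMap ℝ ℂ)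
    (lam'' : SchwartzMap (Fin 3 → ℝ) ℂ) (ε : Fin N → Fin n → ℝ)
    (k : Fin N → Fin n → Fin 4 → ℝ) : ℂ :=
  ∫ a : Fin N → Fin n → Fin 4 → ℝ,
    Set.indicator {a : Fin N → Fin n → Fin 4 → ℝ |
        ∀ M L : Fin N, (M : ℕ) + 1 = (L : ℕ) → meanPt (a M) 0 ≤ meanPt (a L) 0}
      (fun a => (∏ M, gaussCutoff lam' lam'' (a M)) *
        Complex.exp (Complex.I *
          ((∑ M, ∑ j, ε M j * mink (k M j) (a M j) : ℝ) : ℂ))) a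

lemma kd_meanPt_apply {n : ℕ} (a : Fin n → Fin 4 → ℝ) (μ : Fin 4) :
    meanPt a μ = (n : ℝ)⁻¹ * ∑ j, a j μ := by
  simp [meanPt, Finset.sum_apply]

/-- The involution swapping the mean of `a` with an auxiliary variable `s`. -/
noncomputable def kdT (n N : ℕ) :
    ((Fin N → Fin n → Fin 4 → ℝ) × (Fin N → Fin 4 → ℝ)) →ₗ[ℝ]
    ((Fin N → Fin n → Fin 4 → ℝ) × (Fin N → Fin 4 → ℝ)) where
  toFun x := (fun M j μ => x.1 M j μ - meanPt (x.1 M) μ + x.2 M μ, fun M μ => meanPt (x.1 M) μ)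
  map_add' x y := by
    ext <;> simp [kd_meanPt_apply, Finset.sum_add_distrib] <;> ring
  map_smul' c x := by
    ext <;> simp [kd_meanPt_apply, ← Finset.mul_sum] <;> ring

lemma kd_mean_T {n : ℕ} (hn : 1 ≤ n) (a : Fin n → Fin 4 → ℝ) (s : Fin 4 → ℝ) :
    meanPt (fun j μ => a j μ - meanPt a μ + s μ) = s := by
  have hn' : (n : ℝ) ≠ 0 := by positivity
  ext μ
  rw [kd_meanPt_apply]
  simp only [Finset.sum_add_distrib, Finset.sum_sub_distrib, Finset.sum_const, Finset.card_univ,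
    Fintype.card_fin, nsmul_eq_mul, kd_meanPt_apply]
  field_simp
  ring

lemma kdT_invol {n N : ℕ} (hn : 1 ≤ n) (x) : kdT n N (kdT n N x) = x := by
  obtain ⟨a, s⟩ := x
  have h : ∀ M, meanPt (fun j μ => a M j μ - meanPt (a M) μ + s M μ) = s M :=
    fun M => kd_mean_T hn (a M) (s M)
  simp only [kdT, LinearMap.coe_mk, AddHom.coe_mk]
  ext <;> simp [h]

lemma kdT_mp {n N : ℕ} (hn : 1 ≤ n) :
    MeasurePreserving (kdT n N) (volume.prod volume) (volume.prod volume) := by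
  have hinv : (kdT n N).comp (kdT n N) = LinearMap.id := LinearMap.ext (kdT_invol hn)
  have hdet : LinearMap.det (kdT n N) * LinearMap.det (kdT n N) = 1 := by
    rw [← LinearMap.det_comp, hinv, LinearMap.det_id]
  have habs : |LinearMap.det (kdT n N)| = 1 := by
    rcases mul_self_eq_one_iff.mp hdet with h | h <;> simp [h]
  refine ⟨(LinearMap.continuous_of_finiteDimensional _).measurable, ?_⟩
  have i0 : (volume : Measure (Fin 4 → ℝ)).IsAddHaarMeasure := inferInstance
  have i1 : (volume : Measure (Fin n → Fin 4 → ℝ)).IsAddHaarMeasure :=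
    Measure.instIsAddHaarMeasureForallVolumeOfMeasurableAddOfSigmaFinite
  have i2 : (volume : Measure (Fin N → Fin n → Fin 4 → ℝ)).IsAddHaarMeasure :=
    Measure.instIsAddHaarMeasureForallVolumeOfMeasurableAddOfSigmaFinite
  have i3 : (volume : Measure (Fin N → Fin 4 → ℝ)).IsAddHaarMeasure := inferInstance
  have i4 : ((volume : Measure (Fin N → Fin n → Fin 4 → ℝ)).prod
    (volume : Measure (Fin N → Fin 4 → ℝ))).IsAddHaarMeasure :=
    Measure.prod.instIsAddHaarMeasure _ _
  rw [Measure.map_linearMap_addHaar_eq_smul_addHaar]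
  · rw [abs_inv, habs]; simp
  · intro h; simp [h] at habs

/-- `kdT` as a measurable equivalence. -/
noncomputable def kdE {n N : ℕ} (hn : 1 ≤ n) :
    ((Fin N → Fin n → Fin 4 → ℝ) × (Fin N → Fin 4 → ℝ)) ≃ᵐ
    ((Fin N → Fin n → Fin 4 → ℝ) × (Fin N → Fin 4 → ℝ)) where
  toFun := kdT n N
  invFun := kdT n N
  left_inv := kdT_invol hn
  right_inv := kdT_invol hn
  measurable_toFun := (LinearMap.continuous_of_finiteDimensional _).measurable
  measurable_invFun := (LinearMap.continuous_of_finiteDimensional _).measurable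

lemma kd_integral {n N : ℕ} (hn : 1 ≤ n)
    (φ : ((Fin N → Fin n → Fin 4 → ℝ) × (Fin N → Fin 4 → ℝ)) → ℂ) :
    ∫ x, φ x ∂(volume.prod volume) = ∫ x, φ (kdT n N x) ∂(volume.prod volume) := by
  have h : MeasurePreserving (kdE (N := N) hn) (volume.prod volume) (volume.prod volume) :=
    kdT_mp hn
  exact (h.integral_comp' φ).symm

/-- The Gaussian Fourier transform in product form. -/
lemma kd_gauss (n N : ℕ) (q : Fin N → Fin n → Fin 4 → ℝ) :
    ‖∫ a : Fin N → Fin n → Fin 4 → ℝ, ∏ M, ∏ j, ∏ μ,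
      (Complex.exp (Complex.I * (q M j μ : ℂ) * (a M j μ : ℂ)) *
        Complex.exp (-(1/2 : ℂ) * (a M j μ : ℂ) ^ 2))‖ =
      (∏ _M : Fin N, ∏ _j : Fin n, ∏ _μ : Fin 4, ‖((Real.pi : ℂ) / (1/2 : ℂ)) ^ (1/2 : ℂ)‖) *
        ∏ M, Real.exp (-(1/2) * ∑ j, ∑ μ, q M j μ ^ 2) := by
  rw [integral_fintype_prod_volume_eq_prod (fun M (b : Fin n → Fin 4 → ℝ) => ∏ j, ∏ μ,
      (Complex.exp (Complex.I * (q M j μ : ℂ) * (b j μ : ℂ)) *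
        Complex.exp (-(1/2 : ℂ) * (b j μ : ℂ) ^ 2)))]
  rw [norm_prod, ← Finset.prod_mul_distrib]
  refine Finset.prod_congr rfl fun M _ => ?_
  rw [integral_fintype_prod_volume_eq_prod (fun j (b : Fin 4 → ℝ) => ∏ μ,
      (Complex.exp (Complex.I * (q M j μ : ℂ) * (b μ : ℂ)) *
        Complex.exp (-(1/2 : ℂ) * (b μ : ℂ) ^ 2)))]
  rw [norm_prod, Finset.mul_sum, Real.exp_sum, ← Finset.prod_mul_distrib]
  refine Finset.prod_congr rfl fun j _ => ?_
  rw [integral_fintype_prod_volume_eq_prod (fun μ (b : ℝ) =>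
      (Complex.exp (Complex.I * (q M j μ : ℂ) * (b : ℂ)) *
        Complex.exp (-(1/2 : ℂ) * (b : ℂ) ^ 2)))]
  rw [norm_prod, Finset.mul_sum, Real.exp_sum, ← Finset.prod_mul_distrib]
  refine Finset.prod_congr rfl fun μ _ => ?_
  have hre : 0 < (1/2 : ℂ).re := by norm_num
  rw [fourierIntegral_gaussian hre, norm_mul]
  congr 1
  rw [Complex.norm_exp]
  congr 1
  have : -(q M j μ : ℂ) ^ 2 / (4 * (1/2)) = ((-(1/2) * q M j μ ^ 2 : ℝ) : ℂ) := by
    push_cast; ring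
  rw [this, Complex.ofReal_re]

/-- The auxiliary Gaussian. -/
noncomputable def kdγ (n N : ℕ) (s : Fin N → Fin 4 → ℝ) : ℂ :=
  ∏ M, ∏ μ, ((Real.exp (-((n : ℝ) / 2) * s M μ ^ 2) : ℝ) : ℂ)

lemma kdγ_int {n N : ℕ} (hn : 1 ≤ n) : ∫ s, kdγ n N s ≠ 0 := by
  unfold kdγ
  rw [integral_fintype_prod_volume_eq_prod (fun (_ : Fin N) (b : Fin 4 → ℝ) => ∏ μ,
    ((Real.exp (-((n : ℝ) / 2) * b μ ^ 2) : ℝ) : ℂ))]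
  refine Finset.prod_ne_zero_iff.mpr fun M _ => ?_
  rw [integral_fintype_prod_volume_eq_prod (fun (_ : Fin 4) (b : ℝ) =>
    ((Real.exp (-((n : ℝ) / 2) * b ^ 2) : ℝ) : ℂ))]
  refine Finset.prod_ne_zero_iff.mpr fun M _ => ?_
  rw [integral_complex_ofReal, integral_gaussian]
  have : (0 : ℝ) < n := by exact_mod_cast hn
  have h : 0 < Real.pi / ((n : ℝ) / 2) := by positivity
  exact_mod_cast ne_of_gt (Real.sqrt_pos.mpr h)

/-- Signs of the Minkowski metric. -/
noncomputable def kdη (μ : Fin 4) : ℝ := if μ = 0 then 1 else -1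

lemma kdη_sq (μ : Fin 4) : kdη μ ^ 2 = 1 := by unfold kdη; split_ifs <;> norm_num

lemma kd_mink (k a : Fin 4 → ℝ) : mink k a = ∑ μ, kdη μ * k μ * a μ := by
  simp [mink, Fin.sum_univ_four, kdη]; ring

lemma kd_pyth {n : ℕ} (hn : 1 ≤ n) (a : Fin n → Fin 4 → ℝ) (μ : Fin 4) :
    ∑ j, (a j μ - meanPt a μ) ^ 2 + n * meanPt a μ ^ 2 = ∑ j, a j μ ^ 2 := by
  have hn' : (n : ℝ) ≠ 0 := by positivity
  have hs : ∑ j, a j μ = n * meanPt a μ := by rw [kd_meanPt_apply]; field_simp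
  have : ∀ j, (a j μ - meanPt a μ) ^ 2 = a j μ ^ 2 - 2 * meanPt a μ * a j μ + meanPt a μ ^ 2 :=
    fun j => by ring
  simp only [this, Finset.sum_add_distrib, Finset.sum_sub_distrib, ← Finset.mul_sum, hs,
    Finset.sum_const, Finset.card_univ, Fintype.card_fin, nsmul_eq_mul]
  ring

lemma kd_adj {n : ℕ} (p a : Fin n → Fin 4 → ℝ) (μ : Fin 4) :
    ∑ j, p j μ * (a j μ - meanPt a μ) = ∑ j, (p j μ - meanPt p μ) * a j μ := by
  simp only [mul_sub, sub_mul, Finset.sum_sub_distrib, ← Finset.mul_sum, ← Finset.sum_mul,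
    kd_meanPt_apply]
  ring

/-- The function of the means. -/
noncomputable def kdh (N : ℕ) (lam' : SchwartzMap ℝ ℂ) (lam'' : SchwartzMap (Fin 3 → ℝ) ℂ)
    (s : Fin N → Fin 4 → ℝ) : ℂ :=
  Set.indicator {s : Fin N → Fin 4 → ℝ | ∀ M L : Fin N, (M : ℕ) + 1 = (L : ℕ) → s M 0 ≤ s L 0}
    (fun s => ∏ M, (lam' (s M 0) * lam'' (fun i : Fin 3 => s M i.succ))) s

lemma kd_phase {n N : ℕ} (ε : Fin N → Fin n → ℝ) (k : Fin N → Fin n → Fin 4 → ℝ)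
    (a : Fin N → Fin n → Fin 4 → ℝ) (s : Fin N → Fin 4 → ℝ) :
    ∑ M, ∑ j, ε M j * mink (k M j) (fun μ => a M j μ - meanPt (a M) μ + s M μ) =
    ∑ M, ∑ j, ε M j * mink (k M j) (s M) +
    ∑ M, ∑ j, ∑ μ, (kdη μ * (ε M j * k M j μ - meanPt (fun j => ε M j • k M j) μ)) * a M j μ := by
  rw [← Finset.sum_add_distrib]
  refine Finset.sum_congr rfl fun M _ => ?_
  have key : ∑ j, ∑ μ, (kdη μ * (ε M j * k M j μ - meanPt (fun j => ε M j • k M j) μ)) * a M j μ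
      = ∑ j, ∑ μ, (kdη μ * (ε M j * k M j μ)) * (a M j μ - meanPt (a M) μ) := by
    rw [Finset.sum_comm]
    rw [Finset.sum_comm (s := Finset.univ (α := Fin n))]
    refine Finset.sum_congr rfl fun μ _ => ?_
    have := kd_adj (fun j => ε M j • k M j) (a M) μ
    simp only [Pi.smul_apply, smul_eq_mul] at this
    simp only [mul_assoc, ← Finset.mul_sum] at this ⊢
    rw [this]
  rw [key, ← Finset.sum_add_distrib]
  refine Finset.sum_congr rfl fun j _ => ?_
  simp only [kd_mink, Finset.mul_sum]
  rw [← Finset.sum_add_distrib]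
  refine Finset.sum_congr rfl fun μ _ => ?_
  ring

lemma kd_real {n N : ℕ} (hn : 1 ≤ n) (a : Fin N → Fin n → Fin 4 → ℝ) :
    (∏ M, (Real.exp (-(1/2) * ∑ j, ∑ μ : Fin 4, (a M j μ - meanPt (a M) μ) ^ 2) : ℂ)) *
      kdγ n N (fun M μ => meanPt (a M) μ) =
    ∏ M, ∏ j, ∏ μ, Complex.exp (-(1/2 : ℂ) * (a M j μ : ℂ) ^ 2) := by
  unfold kdγ
  rw [← Finset.prod_mul_distrib]
  refine Finset.prod_congr rfl fun M _ => ?_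
  have h1 : ∏ j, ∏ μ, Complex.exp (-(1/2 : ℂ) * (a M j μ : ℂ) ^ 2) =
      ((Real.exp (-(1/2) * ∑ j, ∑ μ, a M j μ ^ 2) : ℝ) : ℂ) := by
    simp only [Finset.mul_sum, Real.exp_sum]
    push_cast
    rfl
  rw [h1, ← Complex.ofReal_prod, ← Complex.ofReal_mul, ← Real.exp_sum, ← Real.exp_add]
  congr 2
  rw [Finset.sum_comm, Finset.sum_comm (s := Finset.univ (α := Fin n)), ← Finset.mul_sum]
  simp only [← kd_pyth hn (a M), Finset.sum_add_distrib, ← Finset.mul_sum]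
  ring

/-- The phase-twisted function of the means. -/
noncomputable def kdH {n N : ℕ} (lam' : SchwartzMap ℝ ℂ) (lam'' : SchwartzMap (Fin 3 → ℝ) ℂ)
    (ε : Fin N → Fin n → ℝ) (k : Fin N → Fin n → Fin 4 → ℝ) (s : Fin N → Fin 4 → ℝ) : ℂ :=
  kdh N lam' lam'' s *
    Complex.exp (Complex.I * ((∑ M, ∑ j, ε M j * mink (k M j) (s M) : ℝ) : ℂ))

lemma kd_pointwise {n N : ℕ} (hn : 1 ≤ n) (lam' : SchwartzMap ℝ ℂ)
    (lam'' : SchwartzMap (Fin 3 → ℝ) ℂ) (ε : Fin N → Fin n → ℝ)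
    (k : Fin N → Fin n → Fin 4 → ℝ) (a : Fin N → Fin n → Fin 4 → ℝ) (s : Fin N → Fin 4 → ℝ) :
    Set.indicator {a : Fin N → Fin n → Fin 4 → ℝ |
        ∀ M L : Fin N, (M : ℕ) + 1 = (L : ℕ) → meanPt (a M) 0 ≤ meanPt (a L) 0}
      (fun a => (∏ M, gaussCutoff lam' lam'' (a M)) *
        Complex.exp (Complex.I *
          ((∑ M, ∑ j, ε M j * mink (k M j) (a M j) : ℝ) : ℂ))) (kdT n N (a, s)).1
      * kdγ n N (kdT n N (a, s)).2 =
    (∏ M, ∏ j, ∏ μ,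
      (Complex.exp (Complex.I * ((kdη μ * (ε M j * k M j μ -
          meanPt (fun j => ε M j • k M j) μ) : ℝ) : ℂ) * (a M j μ : ℂ)) *
        Complex.exp (-(1/2 : ℂ) * (a M j μ : ℂ) ^ 2))) * kdH lam' lam'' ε k s := by
  have h : ∀ M, meanPt (fun j μ => a M j μ - meanPt (a M) μ + s M μ) = s M :=
    fun M => kd_mean_T hn (a M) (s M)
  simp only [Finset.prod_mul_distrib]
  rw [← kd_real hn a]
  simp only [kdH, kdh, kdT, LinearMap.coe_mk, AddHom.coe_mk, Set.indicator, Set.mem_setOf_eq, h]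
  split_ifs with hs
  swap
  · simp
  have hph := kd_phase ε k a s
  rw [hph]
  simp only [gaussCutoff, h, Finset.prod_mul_distrib]
  have hexp : (∏ M, ∏ j, ∏ μ, Complex.exp (Complex.I * ((kdη μ * (ε M j * k M j μ -
          meanPt (fun j => ε M j • k M j) μ) : ℝ) : ℂ) * (a M j μ : ℂ))) =
      Complex.exp (Complex.I * ((∑ M, ∑ j, ∑ μ, (kdη μ * (ε M j * k M j μ -
        meanPt (fun j => ε M j • k M j) μ)) * a M j μ : ℝ) : ℂ)) := by
    simp only [← Complex.exp_sum]
    congr 1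
    push_cast
    simp only [Finset.mul_sum, mul_assoc]
  rw [hexp]
  have e : ∀ M j μ, a M j μ - meanPt (a M) μ + s M μ - s M μ = a M j μ - meanPt (a M) μ :=
    fun M j μ => by ring
  simp only [e]
  rw [Complex.ofReal_add, mul_add, Complex.exp_add]
  ring

theorem kernelF_gaussian_decay (n N : ℕ) (hn : 1 ≤ n) (hN : 1 ≤ N)
    (lam' : SchwartzMap ℝ ℂ) (lam'' : SchwartzMap (Fin 3 → ℝ) ℂ)
    (ε : Fin N → Fin n → ℝ) (hε : ∀ M j, ε M j = 1 ∨ ε M j = -1) :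
    ∃ C : ℝ, 0 < C ∧ ∀ k : Fin N → Fin n → Fin 4 → ℝ,
      ‖kernelF n N lam' lam'' ε k‖ ≤
        C * ∏ M, Real.exp (-(1/2) * ∑ j, ∑ μ : Fin 4,
          (ε M j * k M j μ - meanPt (fun j => ε M j • k M j) μ) ^ 2) := by
  have hγ := kdγ_int (N := N) hn
  have hγ' : 0 < ‖∫ s, kdγ n N s‖ := norm_pos_iff.mpr hγ
  set c : ℝ := ∏ _M : Fin N, ∏ _j : Fin n, ∏ _μ : Fin 4,
    ‖((Real.pi : ℂ) / (1/2 : ℂ)) ^ (1/2 : ℂ)‖ with hc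
  have hc0 : 0 ≤ c := by positivity
  set D : ℝ := ∫ s, ‖kdh N lam' lam'' s‖ with hD
  have hD0 : 0 ≤ D := integral_nonneg fun s => norm_nonneg _
  refine ⟨c * D / ‖∫ s, kdγ n N s‖ + 1, by positivity, fun k => ?_⟩
  have main : kernelF n N lam' lam'' ε k * ∫ s, kdγ n N s =
      (∫ a : Fin N → Fin n → Fin 4 → ℝ, ∏ M, ∏ j, ∏ μ,
      (Complex.exp (Complex.I * ((kdη μ * (ε M j * k M j μ -
          meanPt (fun j => ε M j • k M j) μ) : ℝ) : ℂ) * (a M j μ : ℂ)) *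
        Complex.exp (-(1/2 : ℂ) * (a M j μ : ℂ) ^ 2))) * ∫ s, kdH lam' lam'' ε k s := by
    unfold kernelF
    rw [← integral_prod_mul, ← integral_prod_mul, kd_integral hn]
    exact integral_congr_ae (Filter.Eventually.of_forall fun x =>
      kd_pointwise hn lam' lam'' ε k x.1 x.2)
  have hH : ‖∫ s, kdH lam' lam'' ε k s‖ ≤ D := by
    refine (norm_integral_le_integral_norm _).trans (le_of_eq ?_)
    congr 1
    ext s
    rw [kdH, norm_mul, mul_comm Complex.I, Complex.norm_exp_ofReal_mul_I, mul_one]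
  have hn2 := congrArg norm main
  rw [norm_mul, norm_mul, kd_gauss] at hn2
  simp only [mul_pow, kdη_sq, one_mul] at hn2
  rw [← hc] at hn2
  set E := ∏ M, Real.exp (-(1/2) * ∑ j, ∑ μ : Fin 4,
          (ε M j * k M j μ - meanPt (fun j => ε M j • k M j) μ) ^ 2) with hE
  have hE0 : 0 ≤ E := by positivity
  have h1 : ‖kernelF n N lam' lam'' ε k‖ ≤ c * E * D / ‖∫ s, kdγ n N s‖ := by
    rw [le_div_iff₀ hγ', hn2]
    gcongr
  calc _ ≤ _ := h1
    _ = c * D / ‖∫ s, kdγ n N s‖ * E := by ring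
    _ ≤ _ := by nlinarith
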